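/- Let f : ℝ^d → 𝒴 be any deterministic function into a finite set of classes 𝒴, let σ > 0, and let ε be a random vector in ℝ^d whose coordinates are i.i.d. N(0, σ²). Suppose that for a specific x ∈ ℝ^d there exist a class c_A ∈ 𝒴 and reals p_A, p_B ∈ [0,1] such that P(f(x+ε)=c_A) ≥ p_A ≥ p_B ≥ max_{c ≠ c_A} P(f(x+ε)=c). Then for every δ ∈ ℝ^d with ‖δ‖₂ < R, where R = (σ/2)(Φ⁻¹(p_A) − Φ⁻¹(p_B)), one has P(f(x+δ+ε)=c_A) > P(f(x+δ+ε)=c) for all c ≠ c_A (i.e., the smoothed classifier g(x+δ) = argmax_{c} P(f(x+δ+ε)=c) equals c_A). -/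

import Mathlib

open MeasureTheory ProbabilityTheory

/-- The cumulative distribution function of the standard normal distribution `N(0,1)`. -/
noncomputable def Phi : ℝ → ℝ :=
  fun x => ((gaussianReal 0 1) (Set.Iic x)).toReal

/-- The inverse of the standard normal CDF. -/
noncomputable def PhiInv : ℝ → ℝ := Function.invFun Phi

lemma rs_shift1 (m : ℝ) {v : NNReal} (hv : v ≠ 0) :
    gaussianReal m v = (gaussianReal 0 v).withDensity
      (fun x => ENNReal.ofReal (Real.exp ((m * x - m ^ 2 / 2) / v))) := by
  have hv' : (v : ℝ) ≠ 0 := by exact_mod_cast hv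
  rw [gaussianReal_of_var_ne_zero _ hv, gaussianReal_of_var_ne_zero _ hv,
    ← withDensity_mul _ (measurable_gaussianPDF _ _) (by fun_prop)]
  congr 1
  funext x
  simp only [Pi.mul_apply, gaussianPDF, gaussianPDFReal]
  rw [← ENNReal.ofReal_mul (by positivity), mul_assoc _ (Real.exp _), ← Real.exp_add]
  congr 3
  field_simp
  ring

lemma rs_shift {d : ℕ} (δ : Fin d → ℝ) {v : NNReal} (hv : v ≠ 0) :
    (Measure.pi fun _ : Fin d => gaussianReal 0 v).map (fun e => e + δ) =
    (Measure.pi fun _ : Fin d => gaussianReal 0 v).withDensity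
      (fun e => ENNReal.ofReal (Real.exp ((∑ i, δ i * e i - (∑ i, δ i ^ 2) / 2) / v))) := by
  have h1 : (Measure.pi fun _ : Fin d => gaussianReal 0 v).map (fun e => e + δ) =
      Measure.pi fun i => gaussianReal (δ i) v := by
    have := Measure.pi_map_pi (μ := fun _ : Fin d => gaussianReal 0 v)
      (f := fun i x => x + δ i) (fun i => by fun_prop)
    simp only [gaussianReal_map_add_const, zero_add] at this
    exact this
  rw [h1]
  refine Measure.pi_eq (fun s hs => ?_)
  have hint : ∀ i, Integrable (fun x => Real.exp ((δ i * x - δ i ^ 2 / 2) / v))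
      (gaussianReal 0 v) := by
    intro i
    have := (integrable_exp_mul_gaussianReal (μ := 0) (v := v) (δ i / v)).mul_const
      (Real.exp (-(δ i ^ 2 / 2 / v)))
    refine this.congr (Filter.Eventually.of_forall fun x => ?_)
    simp only
    rw [← Real.exp_add]; congr 1; ring
  have hw : ∀ e : Fin d → ℝ, Real.exp ((∑ i, δ i * e i - (∑ i, δ i ^ 2) / 2) / v) =
      ∏ i, Real.exp ((δ i * e i - δ i ^ 2 / 2) / v) := by
    intro e
    rw [← Real.exp_sum, ← Finset.sum_div, Finset.sum_sub_distrib, Finset.sum_div]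
  simp_rw [hw]
  have hms : MeasurableSet (Set.pi Set.univ s) := MeasurableSet.univ_pi hs
  have hI : Integrable (fun e : Fin d → ℝ => ∏ i, Real.exp ((δ i * e i - δ i ^ 2 / 2) / v))
      (Measure.pi fun _ : Fin d => gaussianReal 0 v) := Integrable.fintype_prod (fun i => hint i)
  rw [withDensity_apply _ hms, ← ofReal_integral_eq_lintegral_ofReal hI.integrableOn
    (Filter.Eventually.of_forall fun e => by positivity)]
  have hr : ∀ i, gaussianReal (δ i) v (s i) = ENNReal.ofReal
      (∫ x, (s i).indicator (fun x => Real.exp ((δ i * x - δ i ^ 2 / 2) / v)) x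
        ∂(gaussianReal 0 v)) := by
    intro i
    rw [rs_shift1 _ hv, withDensity_apply _ (hs i), integral_indicator (hs i),
      ← ofReal_integral_eq_lintegral_ofReal (hint i).integrableOn
      (Filter.Eventually.of_forall fun e => by positivity)]
  simp_rw [hr]
  rw [← ENNReal.ofReal_prod_of_nonneg (fun i _ => integral_nonneg fun x =>
    Set.indicator_nonneg (fun _ _ => by positivity) _), ← integral_fintype_prod_eq_prod,
    ← integral_indicator hms]
  congr 2
  funext e
  by_cases he : e ∈ Set.pi Set.univ s
  · rw [Set.indicator_of_mem he]
    refine Finset.prod_congr rfl fun i _ => ?_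
    rw [Set.indicator_of_mem (he i trivial)]
  · rw [Set.indicator_of_notMem he]
    simp only [Set.mem_pi, Set.mem_univ, true_imp_iff, not_forall] at he
    obtain ⟨i, hi⟩ := he
    rw [Finset.prod_eq_zero (Finset.mem_univ i)]
    rw [Set.indicator_of_notMem hi]

lemma rs_law {d : ℕ} (δ : Fin d → ℝ) (v w : NNReal) (hw : (w : ℝ) = v * ∑ i, δ i ^ 2) :
    (Measure.pi fun _ : Fin d => gaussianReal 0 v).map (fun e => ∑ i, δ i * e i) =
      gaussianReal 0 w := by
  refine Measure.ext_of_charFun (funext fun t => ?_)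
  rw [charFun_apply, integral_map
    (Measurable.aemeasurable (by fun_prop)) (by fun_prop), charFun_gaussianReal]
  have : ∀ e : Fin d → ℝ, Complex.exp ((inner ℝ (∑ i, δ i * e i) t : ℝ) * Complex.I) =
      ∏ i, Complex.exp ((inner ℝ (e i) (δ i * t) : ℝ) * Complex.I) := by
    intro e
    rw [← Complex.exp_sum, ← Finset.sum_mul, ← Complex.ofReal_sum]
    congr 3
    simp only [RCLike.inner_apply, conj_trivial, Finset.mul_sum]
    refine Finset.sum_congr rfl fun i _ => ?_
    ring
  simp_rw [this]
  rw [integral_fintype_prod_eq_prod (fun i x => Complex.exp ((inner ℝ x (δ i * t) : ℝ) * Complex.I))]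
  simp_rw [← charFun_apply, charFun_gaussianReal]
  rw [← Complex.exp_sum]
  congr 1
  have hw' : (w : ℂ) = v * ∑ i, (δ i : ℂ) ^ 2 := by exact_mod_cast congrArg (fun r : ℝ => (r : ℂ)) hw
  rw [hw']
  simp [Finset.mul_sum, Finset.sum_mul, Finset.sum_div]
  refine Finset.sum_congr rfl fun i _ => ?_
  ring

lemma rs_Phi_scale (s a : ℝ) (hs : 0 < s) (w : NNReal) (hw : (w : ℝ) = s ^ 2) :
    (gaussianReal 0 w).real (Set.Iic (s * a)) = Phi a := by
  have h := gaussianReal_map_const_mul (μ := 0) (v := 1) s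
  have hw' : NNReal.mk (s ^ 2) (sq_nonneg s) * 1 = w := by
    ext; rw [mul_one, hw]; rfl
  rw [mul_zero, hw'] at h
  rw [← h, measureReal_def, Measure.map_apply (by fun_prop) measurableSet_Iic, Phi]
  congr 2
  ext y
  simp only [Set.mem_preimage, Set.mem_Iic]
  exact mul_le_mul_iff_right₀ hs

lemma rs_Phi_strictMono : StrictMono Phi := by
  intro x y hxy
  have : 0 < (gaussianReal 0 1).real (Set.Ioc x y) := by
    rw [measureReal_def, ENNReal.toReal_pos_iff]
    refine ⟨pos_iff_ne_zero.2 fun h => ?_, measure_lt_top _ _⟩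
    have := gaussianReal_absolutelyContinuous' 0 (v := 1) one_ne_zero h
    simp at this
    linarith
  have h2 : (gaussianReal 0 1).real (Set.Iic y) = (gaussianReal 0 1).real (Set.Iic x) +
      (gaussianReal 0 1).real (Set.Ioc x y) := by
    rw [← Set.Iic_union_Ioc_eq_Iic hxy.le, measureReal_union (Set.Iic_disjoint_Ioc le_rfl) measurableSet_Ioc]
  simp only [measureReal_def] at this h2
  simp only [Phi]
  linarith

lemma rs_Phi_neg (x : ℝ) : Phi (-x) = 1 - Phi x := by
  have : NullSingletonClass (gaussianReal 0 1) := nullSingletonClass_gaussianReal one_ne_zero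
  have h := gaussianReal_map_neg (μ := 0) (v := 1)
  rw [neg_zero] at h
  have h1 : (gaussianReal 0 1).real (Set.Iic (-x)) = (gaussianReal 0 1).real (Set.Ici x) := by
    conv_lhs => rw [← h, measureReal_def, Measure.map_apply (by fun_prop) measurableSet_Iic]
    rw [measureReal_def]; congr 2; ext y; simp
  have h2 : (gaussianReal 0 1).real (Set.Ici x) = (gaussianReal 0 1).real (Set.Ioi x) := 
    measureReal_congr Ioi_ae_eq_Ici.symm
  have h3 := probReal_compl_eq_one_sub (μ := gaussianReal 0 1) (measurableSet_Iic (a := x))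
  rw [Set.compl_Iic] at h3
  simp only [Phi, ← measureReal_def]
  linarith

lemma rs_Phi_surj (p : ℝ) (h0 : 0 < p) (h1 : p < 1) : ∃ a, Phi a = p := by
  have : NullSingletonClass (gaussianReal 0 1) := nullSingletonClass_gaussianReal one_ne_zero
  have hP : Phi = cdf (gaussianReal 0 1) := by
    funext x; rw [cdf_eq_real]; rfl
  have hc : Continuous Phi := by
    rw [hP, continuous_iff_continuousAt]
    intro x
    rw [(monotone_cdf _).continuousAt_iff_leftLim_eq_rightLim, StieltjesFunction.rightLim_eq]
    have := StieltjesFunction.measure_singleton (cdf (gaussianReal 0 1)) x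
    rw [measure_cdf, measure_singleton] at this
    have h := ENNReal.ofReal_eq_zero.1 this.symm
    have h' := (monotone_cdf (gaussianReal 0 1)).leftLim_le (le_refl x)
    linarith
  have ht := tendsto_cdf_atTop (gaussianReal 0 1)
  have hb := tendsto_cdf_atBot (gaussianReal 0 1)
  rw [← hP] at ht hb
  obtain ⟨a, ha⟩ := (hb.eventually (gt_mem_nhds h0)).exists
  obtain ⟨b, hb⟩ := (ht.eventually (lt_mem_nhds h1)).exists
  have := mem_range_of_exists_le_of_exists_ge hc ⟨a, ha.le⟩ ⟨b, hb.le⟩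
  exact this

lemma rs_NP {d : ℕ} (δ : Fin d → ℝ) (σ : ℝ) (hσ : 0 < σ) (A : Set (Fin d → ℝ))
    (hA : MeasurableSet A) (a : ℝ) (μ : Measure (Fin d → ℝ))
    (hμ : μ = Measure.pi fun _ : Fin d => gaussianReal 0 ((σ ^ 2).toNNReal))
    (h : Phi a ≤ μ.real A) :
    Phi (a - Real.sqrt (∑ i, δ i ^ 2) / σ) ≤ (μ.map (fun e => e + δ)).real A := by
  have : IsProbabilityMeasure μ := by rw [hμ]; infer_instance
  have hν : IsProbabilityMeasure (μ.map (fun e => e + δ)) :=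
    Measure.isProbabilityMeasure_map (by fun_prop)
  set n := Real.sqrt (∑ i, δ i ^ 2) with hn
  have hnn : n ^ 2 = ∑ i, δ i ^ 2 := Real.sq_sqrt (Finset.sum_nonneg fun i _ => sq_nonneg _)
  by_cases hn0 : n = 0
  · have hδ : δ = 0 := by
      rw [hn0] at hnn
      funext i
      have := (Finset.sum_eq_zero_iff_of_nonneg (fun i _ => sq_nonneg (δ i))).1
        (by simpa using hnn.symm) i (Finset.mem_univ i)
      simpa using this
    rw [hn0, hδ]
    simpa using h
  have hnpos : 0 < n := lt_of_le_of_ne (Real.sqrt_nonneg _) (Ne.symm hn0)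
  set v := (σ ^ 2).toNNReal with hv
  have hvr : (v : ℝ) = σ ^ 2 := Real.coe_toNNReal _ (by positivity)
  have hv0 : v ≠ 0 := by
    intro h0; rw [h0] at hvr; have h00 := pow_pos hσ 2; simp at hvr; linarith
  have hvpos : (0 : ℝ) < v := by rw [hvr]; positivity
  let S : (Fin d → ℝ) → ℝ := fun e => ∑ i, δ i * e i
  have hS : Measurable S := by fun_prop
  let w : NNReal := ((σ * n) ^ 2).toNNReal
  have hw : (w : ℝ) = (σ * n) ^ 2 := Real.coe_toNNReal _ (by positivity)
  have hlaw : μ.map S = gaussianReal 0 w := by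
    rw [hμ]; exact rs_law δ v w (by rw [hw, hvr, ← hnn]; ring)
  have hhalf : ∀ b : ℝ, μ.real {e | S e ≤ σ * n * b} = Phi b := by
    intro b
    rw [← rs_Phi_scale (σ * n) b (by positivity) w hw, ← hlaw, measureReal_def, measureReal_def,
      Measure.map_apply hS measurableSet_Iic]
    rfl
  set H : Set (Fin d → ℝ) := {e | S e ≤ σ * n * a} with hH
  have hHm : MeasurableSet H := measurableSet_le hS measurable_const
  have hνH : (μ.map (fun e => e + δ)).real H = Phi (a - n / σ) := by
    rw [← hhalf, measureReal_def, measureReal_def, Measure.map_apply (by fun_prop) hHm]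
    congr 2
    ext e
    have : S (e + δ) = S e + n ^ 2 := by
      simp only [S, Pi.add_apply, mul_add, Finset.sum_add_distrib, hnn]
      congr 1
      exact Finset.sum_congr rfl fun i _ => by ring
    have h2 : σ * n * (a - n / σ) = σ * n * a - n ^ 2 := by field_simp
    simp only [hH, Set.mem_preimage, Set.mem_ofPred_eq, this, h2]
    constructor <;> intro _ <;> linarith
  rw [← hνH]
  have hd := rs_shift δ hv0
  rw [← hμ] at hd
  let k : ℝ := Real.exp ((σ * n * a - (∑ i, δ i ^ 2) / 2) / v)
  have hk : 0 < k := Real.exp_pos _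
  -- lower bound off the half space
  have hlow : k * μ.real (A \ H) ≤ (μ.map (fun e => e + δ)).real (A \ H) := by
    have hm := hA.diff hHm
    have : ENNReal.ofReal k * μ (A \ H) ≤ (μ.map (fun e => e + δ)) (A \ H) := by
      rw [hd, withDensity_apply _ hm, ← setLIntegral_const]
      refine setLIntegral_mono' hm fun e he => ENNReal.ofReal_le_ofReal (Real.exp_le_exp.2 ?_)
      have h1 : σ * n * a < S e := not_le.1 he.2
      have h1' : σ * n * a < ∑ i, δ i * e i := h1
      gcongr
    have := ENNReal.toReal_mono (measure_ne_top _ _) this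
    rwa [ENNReal.toReal_mul, ENNReal.toReal_ofReal hk.le] at this
  have hup : (μ.map (fun e => e + δ)).real (H \ A) ≤ k * μ.real (H \ A) := by
    have hm := hHm.diff hA
    have : (μ.map (fun e => e + δ)) (H \ A) ≤ ENNReal.ofReal k * μ (H \ A) := by
      rw [hd, withDensity_apply _ hm, ← setLIntegral_const]
      refine setLIntegral_mono' hm fun e he => ENNReal.ofReal_le_ofReal (Real.exp_le_exp.2 ?_)
      have h1' : ∑ i, δ i * e i ≤ σ * n * a := he.1
      gcongr
    have := ENNReal.toReal_mono (ENNReal.mul_ne_top ENNReal.ofReal_ne_top (measure_ne_top _ _)) this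
    rwa [ENNReal.toReal_mul, ENNReal.toReal_ofReal hk.le] at this
  have e1 := measureReal_sdiff_add_inter (μ := μ) (s := A) hHm
  have e2 := measureReal_sdiff_add_inter (μ := μ) (s := H) hA
  have e3 := measureReal_sdiff_add_inter (μ := μ.map (fun e => e + δ)) (s := A) hHm
  have e4 := measureReal_sdiff_add_inter (μ := μ.map (fun e => e + δ)) (s := H) hA
  rw [Set.inter_comm] at e2 e4
  rw [← hhalf] at h
  have h5 : μ.real (H \ A) ≤ μ.real (A \ H) := by
    have : μ.real H ≤ μ.real A := h
    linarith
  have h6 := mul_le_mul_of_nonneg_left h5 hk.le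
  linarith

/-- Randomized smoothing with isotropic Gaussian noise (Cohen et al.). -/
theorem isotropic_randomized_smoothing
    {d : ℕ} {Y : Type*} [Fintype Y] [MeasurableSpace Y] [MeasurableSingletonClass Y]
    (f : (Fin d → ℝ) → Y) (hf : Measurable f)
    (σ : ℝ) (hσ : 0 < σ)
    (noise : Measure (Fin d → ℝ))
    (hnoise : noise = Measure.pi fun _ : Fin d => gaussianReal 0 ((σ ^ 2).toNNReal))
    (x : Fin d → ℝ) (cA : Y) (pA pB : ℝ)
    (hpA : pA ∈ Set.Icc (0 : ℝ) 1) (hpB : pB ∈ Set.Icc (0 : ℝ) 1)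
    (hA : (noise {e | f (x + e) = cA}).toReal ≥ pA)
    (hAB : pA ≥ pB)
    (hB : ∀ c : Y, c ≠ cA → pB ≥ (noise {e | f (x + e) = c}).toReal)
    (δ : Fin d → ℝ)
    (hδ : Real.sqrt (∑ i, δ i ^ 2) < σ / 2 * (PhiInv pA - PhiInv pB)) :
    ∀ c : Y, c ≠ cA →
      (noise {e | f (x + δ + e) = cA}).toReal >
        (noise {e | f (x + δ + e) = c}).toReal := by
  intro c hc
  have hprob : IsProbabilityMeasure noise := by rw [hnoise]; infer_instance
  have hν : IsProbabilityMeasure (noise.map (fun e => e + δ)) :=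
    Measure.isProbabilityMeasure_map (by fun_prop)
  have hvr : ((σ ^ 2).toNNReal : ℝ) = σ ^ 2 := Real.coe_toNNReal _ (by positivity)
  have hv0 : (σ ^ 2).toNNReal ≠ 0 := by
    intro h0; rw [h0] at hvr; have h00 := pow_pos hσ 2; simp at hvr; linarith
  have hac : noise.map (fun e => e + δ) ≪ noise := by
    rw [hnoise, rs_shift δ hv0]
    exact withDensity_absolutelyContinuous _ _
  let E : Y → Set (Fin d → ℝ) := fun c => {e | f (x + e) = c}
  have hE : ∀ c, MeasurableSet (E c) := fun c =>
    (hf.comp (measurable_const_add x)) (measurableSet_singleton c)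
  have hsh : ∀ c, (noise {e | f (x + δ + e) = c}).toReal =
      (noise.map (fun e => e + δ)).real (E c) := by
    intro c
    rw [measureReal_def, Measure.map_apply (by fun_prop) (hE c)]
    congr 2
    ext e
    simp only [E, Set.mem_ofPred_eq, Set.mem_preimage]
    rw [add_assoc, add_comm δ e]
  rw [hsh, hsh]
  replace hA : pA ≤ noise.real (E cA) := hA
  replace hB : ∀ c, c ≠ cA → noise.real (E c) ≤ pB := hB
  -- the degenerate case
  have hdeg : noise (E cA)ᶜ = 0 → (noise.map (fun e => e + δ)).real (E cA) >
      (noise.map (fun e => e + δ)).real (E c) := by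
    intro h0
    have h1 := hac h0
    have h2 : (noise.map (fun e => e + δ)).real (E cA)ᶜ = 0 := by
      rw [measureReal_def, h1]; rfl
    have h3 := probReal_compl_eq_one_sub (μ := noise.map (fun e => e + δ)) (hE cA)
    have h4 : (noise.map (fun e => e + δ)).real (E c) ≤
        (noise.map (fun e => e + δ)).real (E cA)ᶜ := by
      refine measureReal_mono fun e he he' => hc ?_
      exact he.symm.trans he'
    linarith
  have hRpos : PhiInv pB < PhiInv pA := by
    have h1 := (Real.sqrt_nonneg _).trans_lt hδ
    have h2 := pos_of_mul_pos_right h1 (by positivity)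
    linarith
  by_cases hA1 : pA = 1
  · apply hdeg
    rw [hA1] at hA
    have h3 := probReal_compl_eq_one_sub (μ := noise) (hE cA)
    have h4 : noise.real (E cA)ᶜ = 0 := le_antisymm (by linarith) measureReal_nonneg
    exact (measureReal_eq_zero_iff).1 h4
  by_cases hB0 : pB = 0
  · apply hdeg
    have hsub : (E cA)ᶜ ⊆ ⋃ c ∈ {c : Y | c ≠ cA}, E c := by
      intro e he
      simp only [Set.mem_iUnion]
      exact ⟨f (x + e), he, rfl⟩
    refine measure_mono_null hsub ((measure_biUnion_null_iff (Set.to_countable _)).2 fun c hc => ?_)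
    have := hB c hc
    rw [hB0] at this
    exact (measureReal_eq_zero_iff).1 (le_antisymm this measureReal_nonneg)
  have hB0' : 0 < pB := lt_of_le_of_ne hpB.1 (Ne.symm hB0)
  have hA1' : pA < 1 := lt_of_le_of_ne hpA.2 hA1
  have hPA : Phi (PhiInv pA) = pA :=
    Function.invFun_eq (rs_Phi_surj pA (by linarith) hA1')
  have hPB : Phi (PhiInv pB) = pB :=
    Function.invFun_eq (rs_Phi_surj pB hB0' (by linarith))
  have hbA := rs_NP δ σ hσ (E cA) (hE cA) (PhiInv pA) noise hnoise (by rw [hPA]; exact hA)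
  have hbB := rs_NP δ σ hσ (E c)ᶜ (hE c).compl (-PhiInv pB) noise hnoise (by
    rw [rs_Phi_neg, hPB, probReal_compl_eq_one_sub (hE c)]
    linarith [hB c hc])
  rw [probReal_compl_eq_one_sub (hE c)] at hbB
  have e1 : -PhiInv pB - Real.sqrt (∑ i, δ i ^ 2) / σ =
    -(PhiInv pB + Real.sqrt (∑ i, δ i ^ 2) / σ) := by ring
  rw [e1, rs_Phi_neg] at hbB
  have hlt : PhiInv pB + Real.sqrt (∑ i, δ i ^ 2) / σ <
      PhiInv pA - Real.sqrt (∑ i, δ i ^ 2) / σ := by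
    have : Real.sqrt (∑ i, δ i ^ 2) / σ < (PhiInv pA - PhiInv pB) / 2 := by
      rw [div_lt_iff₀ hσ]; linarith
    linarith
  have := rs_Phi_strictMono hlt
  linarith
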